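/- arXiv:0909.5097 — 2 statements merged into one kernel-verified Lean document; each statement's English description precedes it below -/
import Mathlib

section
/- Let A be a relational structure. If A is existential-positively closed for its primitive positive theory pp-Th(A), then A is a core, i.e., every endomorphism of A is an embedding. Conversely, if A is pp-|A|-saturated (or finite), every relation pp-definable in A without parameters is itself one of the relations of A, and A is a core, then A is existential-positively closed for pp-Th(A). -/
open FirstOrder FirstOrder.Language Cardinal

universe u v w

namespace PaperCSP

variable {L : FirstOrder.Language.{u, v}}

/-- Primitive positive bounded formulas: built from `⊥`, equalities and atomic relations
using conjunction and existential quantification. -/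
inductive IsPP {α : Type w} : ∀ {n : ℕ}, L.BoundedFormula α n → Prop
  | falsum {n} : IsPP (BoundedFormula.falsum : L.BoundedFormula α n)
  | equal {n} (t₁ t₂ : L.Term (α ⊕ Fin n)) : IsPP (BoundedFormula.equal t₁ t₂)
  | rel {n ℓ} (R : L.Relations ℓ) (ts : Fin ℓ → L.Term (α ⊕ Fin n)) :
      IsPP (BoundedFormula.rel R ts)
  | inf {n} {φ ψ : L.BoundedFormula α n} : IsPP φ → IsPP ψ → IsPP (φ ⊓ ψ)
  | ex {n} {φ : L.BoundedFormula α (n + 1)} : IsPP φ → IsPP φ.ex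

/-- Existential positive bounded formulas: additionally closed under disjunction. -/
inductive IsEP {α : Type w} : ∀ {n : ℕ}, L.BoundedFormula α n → Prop
  | falsum {n} : IsEP (BoundedFormula.falsum : L.BoundedFormula α n)
  | equal {n} (t₁ t₂ : L.Term (α ⊕ Fin n)) : IsEP (BoundedFormula.equal t₁ t₂)
  | rel {n ℓ} (R : L.Relations ℓ) (ts : Fin ℓ → L.Term (α ⊕ Fin n)) :
      IsEP (BoundedFormula.rel R ts)
  | inf {n} {φ ψ : L.BoundedFormula α n} : IsEP φ → IsEP ψ → IsEP (φ ⊓ ψ)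
  | sup {n} {φ ψ : L.BoundedFormula α n} : IsEP φ → IsEP ψ → IsEP (φ ⊔ ψ)
  | ex {n} {φ : L.BoundedFormula α (n + 1)} : IsEP φ → IsEP φ.ex

/-- A relation is pp-definable (without parameters) in a structure. -/
def PPDefinable (L : FirstOrder.Language.{u, v}) (A : Type w) [L.Structure A] {m : ℕ} (R : Set ((Fin m) → A)) : Prop :=
  ∃ φ : L.Formula (Fin m), IsPP φ ∧ R = {x | φ.Realize x}

/-- A relation is ep-definable (without parameters) in a structure. -/
def EPDefinable (L : FirstOrder.Language.{u, v}) (A : Type w) [L.Structure A] {m : ℕ} (R : Set ((Fin m) → A)) : Prop :=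
  ∃ φ : L.Formula (Fin m), IsEP φ ∧ R = {x | φ.Realize x}

/-- A relation is first-order definable (without parameters) in a structure. -/
def FODefinable (L : FirstOrder.Language.{u, v}) (A : Type w) [L.Structure A] {m : ℕ} (R : Set ((Fin m) → A)) : Prop :=
  ∃ φ : L.Formula (Fin m), R = {x | φ.Realize x}

/-- The direct power structure on `I → A`: relations hold iff they hold component-wise. -/
instance piStructure (I : Type*) (A : Type w) [L.Structure A] : L.Structure (I → A) where
  funMap f x i := Structure.funMap f fun j => x j i
  RelMap r x := ∀ i, Structure.RelMap r fun j => x j i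

/-- An `m`-ary relation `R` on `A` is preserved by (invariant under) a function
`f : A^I → A` if it is preserved component-wise. -/
def Preserves {A : Type w} {I : Type*} (f : (I → A) → A)
    {m : ℕ} (R : Set (Fin m → A)) : Prop :=
  ∀ a : Fin m → I → A, (∀ i : I, (fun j => a j i) ∈ R) → (fun j => f (a j)) ∈ R

/-- `R` is preserved by all ω-polymorphisms (homomorphisms `A^κ → A`, `κ ≤ ω`). -/
def PreservedByOmegaPolymorphisms (L : FirstOrder.Language.{u, v}) (A : Type w) [L.Structure A] {m : ℕ}
    (R : Set (Fin m → A)) : Prop :=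
  ∀ (I : Type) [Countable I] (f : (I → A) →[L] A), Preserves (f : (I → A) → A) R

/-- The primitive positive theory of a structure: all true pp-sentences together with
the negations of all false pp-sentences. -/
def ppTheory (L : FirstOrder.Language.{u, v}) (A : Type w) [L.Structure A] : L.Theory :=
  {σ | IsPP σ ∧ A ⊨ σ} ∪ {σ | ∃ φ : L.Sentence, IsPP φ ∧ ¬A ⊨ φ ∧ σ = φ.not}

/-- `A` is an existential-positively closed (epc) model of `T`. -/
def IsEPC (T : L.Theory) (A : Type w) [L.Structure A] : Prop :=
  A ⊨ T ∧ ∀ (B : Type w) [L.Structure B], B ⊨ T →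
    ∀ (h : A →[L] B) (k : ℕ) (φ : L.Formula (Fin k)), IsPP φ →
      ∀ a : Fin k → A, φ.Realize (fun i => h (a i)) → φ.Realize a

/-- A structure is a core if every endomorphism is an embedding. -/
def IsCore (L : FirstOrder.Language.{u, v}) (A : Type w) [L.Structure A] : Prop :=
  ∀ h : A →[L] A, Function.Injective h ∧
    ∀ {n : ℕ} (r : L.Relations n) (x : Fin n → A),
      Structure.RelMap r (fun i => h (x i)) → Structure.RelMap r x

/-- A set of formulas in `n` free variables is satisfiable together with the theory `T`. -/
def SatWith (T : L.Theory) {n : ℕ} (Φ : Set (L.Formula (Fin n))) : Prop :=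
  ∃ (N : Type (max u v)) (S : L.Structure N), letI := S
    Nonempty N ∧ N ⊨ T ∧ ∃ b : Fin n → N, ∀ φ ∈ Φ, φ.Realize b

/-- A pp-`n`-type of a theory `T`. -/
def IsPPType (T : L.Theory) {n : ℕ} (p : Set (L.Formula (Fin n))) : Prop :=
  (∀ φ ∈ p, IsPP φ) ∧ SatWith T p

/-- A maximal pp-`n`-type of a theory `T`. -/
def IsMaximalPPType (T : L.Theory) {n : ℕ} (p : Set (L.Formula (Fin n))) : Prop :=
  IsPPType T p ∧ ∀ φ : L.Formula (Fin n), IsPP φ → φ ∉ p → ¬SatWith T (insert φ p)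

/-- `B` is pp-`κ`-saturated: over any set of fewer than `κ` parameters, every set of
pp-formulas in one free variable all of whose finite subsets are realised (i.e. every
pp-1-type of the expansion) is realised. -/
def IsPPSaturated (L : FirstOrder.Language.{u, v}) (κ : Cardinal.{w}) (B : Type w) [L.Structure B] : Prop :=
  ∀ (β : Type w), #β < κ → ∀ (v : β → B) (p : Set (L.Formula (β ⊕ Unit))),
    (∀ φ ∈ p, IsPP φ) →
    (∀ s : Finset (L.Formula (β ⊕ Unit)), ↑s ⊆ p →
        ∃ c : B, ∀ φ ∈ s, Formula.Realize φ (Sum.elim v fun _ => c)) →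
    ∃ c : B, ∀ φ ∈ p, Formula.Realize φ (Sum.elim v fun _ => c)

/-- `B` is `κ`-saturated: over any set of fewer than `κ` parameters, every set of
formulas in one free variable all of whose finite subsets are realised (i.e. every
1-type of the expansion) is realised. -/
def IsSaturated (L : FirstOrder.Language.{u, v}) (κ : Cardinal.{w}) (B : Type w) [L.Structure B] : Prop :=
  ∀ (β : Type w), #β < κ → ∀ (v : β → B) (p : Set (L.Formula (β ⊕ Unit))),
    (∀ s : Finset (L.Formula (β ⊕ Unit)), ↑s ⊆ p →
        ∃ c : B, ∀ φ ∈ s, Formula.Realize φ (Sum.elim v fun _ => c)) →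
    ∃ c : B, ∀ φ ∈ p, Formula.Realize φ (Sum.elim v fun _ => c)

/-- The homomorphism lifting property. -/
def HomLifting (L : FirstOrder.Language.{u, v}) (M : Type w) [L.Structure M] : Prop :=
  ∀ (k : ℕ) (a : Fin k → (ℕ → M)) (b : Fin k → M),
    (∀ φ : L.Formula (Fin k), IsPP φ →
        Formula.Realize (M := ℕ → M) φ a → Formula.Realize φ b) →
    ∃ f : (ℕ → M) →[L] M, ∀ i, f (a i) = b i

/-- A function `f : A^α → A` is essentially unary. -/
def EssentiallyUnary {A : Type w} {α : Type*} (f : (α → A) → A) : Prop :=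
  ∃ (β : α) (g : A → A), ∀ x : α → A, f x = g (x β)



theorem IsPP.relabel' {α β : Type*} {n : ℕ} (g : α → β ⊕ Fin n) {k : ℕ}
    {φ : L.BoundedFormula α k} (h : IsPP φ) : IsPP (φ.relabel g) := by
  induction h with
  | falsum => exact IsPP.falsum
  | equal t₁ t₂ => exact IsPP.equal _ _
  | rel R ts => exact IsPP.rel _ _
  | inf _ _ h1 h2 => exact IsPP.inf h1 h2
  | ex _ h => 
    rw [BoundedFormula.relabel_ex]
    exact IsPP.ex h

theorem pp_fin [L.IsRelational] {α : Type*} {n : ℕ} {φ : L.BoundedFormula α n} (h : IsPP φ) :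
    ∃ F : Finset α, ∀ (γ : Type) (f : γ → α), (∀ a ∈ F, ∃ c, f c = a) →
      ∃ ψ : L.BoundedFormula γ n, IsPP ψ ∧ ∀ (M : Type w) [L.Structure M] (v : α → M)
        (xs : Fin n → M), φ.Realize v xs ↔ ψ.Realize (v ∘ f) xs := by
  classical
  have tm : ∀ {n : ℕ} (t : L.Term (α ⊕ Fin n)), ∃ F : Finset α, ∀ (γ : Type) (f : γ → α),
      (∀ a ∈ F, ∃ c, f c = a) → ∃ t' : L.Term (γ ⊕ Fin n), ∀ (M : Type w) [L.Structure M]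
        (v : α → M) (xs : Fin n → M),
        t.realize (Sum.elim v xs) = t'.realize (Sum.elim (v ∘ f) xs) := by
    intro n t
    cases t with
    | var x =>
      cases x with
      | inl a =>
        refine ⟨{a}, fun γ f hf => ?_⟩
        obtain ⟨c, rfl⟩ := hf a (by simp)
        exact ⟨Term.var (Sum.inl c), fun M _ v xs => by simp⟩
      | inr i =>
        exact ⟨∅, fun γ f hf => ⟨Term.var (Sum.inr i), fun M _ v xs => by simp⟩⟩
    | func f _ => exact isEmptyElim f
  induction h with
  | falsum => exact ⟨∅, fun γ f _ => ⟨_, IsPP.falsum, fun M _ v xs => Iff.rfl⟩⟩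
  | equal t₁ t₂ =>
    obtain ⟨F₁, h₁⟩ := tm t₁
    obtain ⟨F₂, h₂⟩ := tm t₂
    refine ⟨F₁ ∪ F₂, fun γ f hf => ?_⟩
    obtain ⟨s₁, h₁⟩ := h₁ γ f fun a ha => hf a (by simp [ha])
    obtain ⟨s₂, h₂⟩ := h₂ γ f fun a ha => hf a (by simp [ha])
    refine ⟨_, IsPP.equal s₁ s₂, fun M _ v xs => ?_⟩
    simp only [BoundedFormula.Realize, h₁, h₂]
  | rel R ts =>
    choose F hF using fun i => tm (ts i)
    refine ⟨Finset.univ.biUnion F, fun γ f hf => ?_⟩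
    choose ss hs using fun i => hF i γ f fun a ha => hf a (by simp; exact ⟨i, ha⟩)
    refine ⟨_, IsPP.rel R ss, fun M _ v xs => ?_⟩
    simp only [BoundedFormula.Realize, hs]
  | inf _ _ h₁ h₂ =>
    obtain ⟨F₁, h₁⟩ := h₁
    obtain ⟨F₂, h₂⟩ := h₂
    refine ⟨F₁ ∪ F₂, fun γ f hf => ?_⟩
    obtain ⟨s₁, p₁, h₁⟩ := h₁ γ f fun a ha => hf a (by simp [ha])
    obtain ⟨s₂, p₂, h₂⟩ := h₂ γ f fun a ha => hf a (by simp [ha])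
    refine ⟨_, IsPP.inf p₁ p₂, fun M _ v xs => ?_⟩
    simp only [BoundedFormula.realize_inf, h₁, h₂]
  | ex _ h =>
    obtain ⟨F, h⟩ := h
    refine ⟨F, fun γ f hf => ?_⟩
    obtain ⟨s, p, h⟩ := h γ f hf
    refine ⟨_, IsPP.ex p, fun M _ v xs => ?_⟩
    simp only [BoundedFormula.realize_ex, h]

theorem pp_conj {D : Type*} (s : Finset (L.Formula (D ⊕ Unit))) (hs : ∀ φ ∈ s, IsPP φ) :
    ∃ χ : L.Formula (D ⊕ Unit), IsPP χ ∧ ∀ (M : Type w) [L.Structure M] (v : D ⊕ Unit → M),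
      χ.Realize v ↔ ∀ φ ∈ s, Formula.Realize φ v := by
  classical
  induction s using Finset.induction_on with
  | empty =>
    refine ⟨BoundedFormula.equal (Term.var (Sum.inl (Sum.inr ())))
      (Term.var (Sum.inl (Sum.inr ()))), IsPP.equal _ _, fun M _ v => ?_⟩
    simp [Formula.Realize, BoundedFormula.Realize]
  | insert φ s _ ih =>
    obtain ⟨χ, p, h⟩ := ih fun ψ hψ => hs ψ (by simp [hψ])
    refine ⟨φ ⊓ χ, IsPP.inf (hs φ (by simp)) p, fun M _ v => ?_⟩
    simp [Formula.realize_inf, h]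

theorem sat_of_finite (A : Type w) [L.Structure A] [Finite A] (κ : Cardinal.{w}) :
    IsPPSaturated L κ A := by
  classical
  intro β _ v p _ hp
  by_contra! hc
  choose f hf hf' using hc
  cases nonempty_fintype A
  obtain ⟨c, hc⟩ := hp (Finset.univ.image f) (by
    intro φ; simp only [Finset.coe_image, Finset.coe_univ, Set.image_univ]
    rintro ⟨c, rfl⟩; exact hf c)
  exact hf' c (hc _ (by simp))

theorem exists_order (A : Type w) : ∃ (_ : LinearOrder A), WellFoundedLT A ∧
    ∀ a : A, #{y // y < a} < #A := by
  classical
  obtain ⟨r, hr, h⟩ := Cardinal.exists_ord_eq A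
  refine ⟨linearOrderOfSTO r, ⟨hr.wf⟩, fun a => ?_⟩
  have := Cardinal.card_typein_lt (r := r) a h
  exact this

theorem exists_rec {A : Type w} [LinearOrder A] [WellFoundedLT A]
    (Q : ∀ a : A, ({y // y < a} → A) → A → Prop) :
    ∃ e : A → A, ∀ a, (∃ c, Q a (fun y => e y.1) c) → Q a (fun y => e y.1) (e a) := by
  classical
  let F : ∀ a : A, (∀ y, y < a → A) → A := fun a rec =>
    if H : ∃ c, Q a (fun y => rec y.1 y.2) c then H.choose else a
  refine ⟨(wellFounded_lt (α := A)).fix F, fun a H => ?_⟩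
  rw [WellFounded.fix_eq]
  have : F a (fun y _ => (wellFounded_lt (α := A)).fix F y) = H.choose := dif_pos H
  rw [this]
  exact H.choose_spec

/-- Partial pp-type preservation on `D`. -/
def Inv {A B : Type w} [L.Structure A] [L.Structure B] (h : A → B) (e : A → A) (D : Set A) :
    Prop :=
  ∀ (k : ℕ) (ψ : L.Formula (Fin k)), IsPP ψ → ∀ x : Fin k → A, (∀ i, x i ∈ D) →
    ψ.Realize (fun i => h (x i)) → ψ.Realize (fun i => e (x i))

theorem inv_directed [L.IsRelational] {A B : Type w} [L.Structure A] [L.Structure B]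
    [LinearOrder A] (hB : B ⊨ ppTheory L A) (h : A → B) (e : A → A) (D : Set A)
    (H : ∀ d ∈ D, Inv (L := L) h e (Set.Iic d)) : Inv (L := L) h e D := by
  intro k ψ hψ x hx hr
  rcases k with _ | k
  · obtain ⟨F, hF⟩ := pp_fin.{u, v, w} hψ
    obtain ⟨σ, hσ, hs⟩ := hF Empty Empty.elim (fun a => a.elim0)
    by_contra hn
    have hA : ¬ A ⊨ (σ : L.Sentence) := by
      intro hA
      apply hn
      refine (hs A _ _).2 ?_
      rw [Subsingleton.elim ((fun i => e (x i)) ∘ Empty.elim) default]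
      exact hA
    have hnB := hB.realize_of_mem (φ := Formula.not σ) (Or.inr ⟨σ, hσ, hA, rfl⟩)
    rw [Sentence.realize_not] at hnB
    apply hnB
    have := (hs B _ _).1 hr
    rw [Subsingleton.elim ((fun i => h (x i)) ∘ Empty.elim) default] at this
    exact this
  · obtain ⟨i, hi⟩ := Finite.exists_max x
    exact H (x i) (hx i) _ ψ hψ x hi hr

theorem exists_endo [L.IsRelational] {A B : Type w} [L.Structure A] [L.Structure B]
    (hs : IsPPSaturated L (#A) A) (hB : B ⊨ ppTheory L A) (h : A → B) :
    ∃ e : A → A, Inv (L := L) h e Set.univ := by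
  classical
  obtain ⟨_, _, hcard⟩ := exists_order A
  let P : ∀ a : A, Set (L.Formula ({y // y < a} ⊕ Unit)) := fun a =>
    {χ | IsPP χ ∧ χ.Realize (Sum.elim (fun y => h y.1) fun _ => h a)}
  obtain ⟨e, he⟩ := exists_rec (A := A) fun a f c =>
    ∀ χ ∈ P a, Formula.Realize χ (Sum.elim f fun _ => c)
  refine ⟨e, inv_directed hB h e _ fun a _ => ?_⟩
  induction a using WellFoundedLT.induction with
  | ind a ih =>
  have hlt : Inv (L := L) h e (Set.Iio a) := inv_directed hB h e _ fun d hd => ih d hd trivial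
  have key := he a (hs _ (hcard a) _ (P a) (fun φ hφ => hφ.1) ?_)
  · intro k ψ hψ x hx hr
    let g : Fin k → {y // y < a} ⊕ Unit := fun i =>
      if hi : x i < a then Sum.inl ⟨x i, hi⟩ else Sum.inr ()
    have hg : ∀ {M : Type w} (f : A → M),
        (Sum.elim (fun y : {y // y < a} => f y.1) fun _ => f a) ∘ g = fun i => f (x i) := by
      intro M f
      funext i
      by_cases hi : x i < a
      · simp [g, hi]
      · have : x i = a := le_antisymm (hx i) (not_lt.1 hi)
        simp [g, this]
    have := key (Formula.relabel g ψ) ⟨hψ.relabel' _, by rw [Formula.realize_relabel, hg]; exact hr⟩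
    rw [Formula.realize_relabel, hg] at this
    exact this
  · intro s hsub
    obtain ⟨χ, pχ, hχ⟩ := pp_conj.{u, v, w} s fun φ hφ => (hsub hφ).1
    have hχB := (hχ B (Sum.elim (fun y : {y // y < a} => h y.1) fun _ => h a)).2
      fun φ hφ => (hsub hφ).2
    let g : {y // y < a} ⊕ Unit → {y // y < a} ⊕ Fin 1 := Sum.map id fun _ => 0
    let θ : L.BoundedFormula {y // y < a} 1 := BoundedFormula.relabel (k := 0) g χ
    have pθ : IsPP θ := pχ.relabel' g
    have hθ : ∀ (M : Type w) [L.Structure M] (v : {y // y < a} → M) (c : M) ,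
        θ.Realize v (Fin.snoc default c) ↔ χ.Realize (Sum.elim v fun _ => c) := by
      intro M _ v c
      refine (BoundedFormula.realize_relabel (n := 0)).trans ?_
      rw [Formula.Realize]
      apply iff_of_eq
      congr 1
      · funext z
        rcases z with z | z
        · simp [g]
        · simp [g, Fin.snoc]
      · exact Subsingleton.elim _ _
    obtain ⟨F, hF⟩ := pp_fin.{u, v, w} pθ.ex
    obtain ⟨ψ, pψ, hψ⟩ := hF (Fin F.card) (fun i => (F.equivFin.symm i).1) (fun a ha =>
      ⟨F.equivFin ⟨a, ha⟩, by simp⟩)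
    have hA := hlt _ ψ pψ (fun i => (F.equivFin.symm i).1.1) (fun i => (F.equivFin.symm i).1.2)
      ((hψ B (fun y => h y.1) default).1
        (BoundedFormula.realize_ex.2 ⟨h a, (hθ B _ _).2 hχB⟩))
    obtain ⟨c, hc⟩ := BoundedFormula.realize_ex.1 ((hψ A (fun y => e y.1) default).2 hA)
    exact ⟨c, (hχ A _).1 ((hθ A _ c).1 hc)⟩

/-- If `A` is epc for its pp-theory, then `A` is a core. Conversely,
if `A` is pp-`|A|`-saturated (or finite), every pp-definable relation of `A` is one of
the relations of `A`, and `A` is a core, then `A` is epc for its pp-theory. -/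
theorem epc_iff_core {L : FirstOrder.Language.{u, v}} [L.IsRelational]
    (A : Type w) [L.Structure A] :
    (IsEPC (ppTheory L A) A → IsCore L A) ∧
    ((IsPPSaturated L (#A) A ∨ Finite A) →
      (∀ (k : ℕ) (R : Set (Fin k → A)), PPDefinable L A R →
        ∃ r : L.Relations k, R = {x | Structure.RelMap r x}) →
      IsCore L A → IsEPC (ppTheory L A) A) := by
  constructor
  · rintro ⟨hT, H⟩ h
    refine ⟨fun a b hab => ?_, fun {n} r x hr => ?_⟩
    · have := H A hT h 2 (BoundedFormula.equal (Term.var (Sum.inl 0)) (Term.var (Sum.inl 1)))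
        (IsPP.equal _ _) ![a, b] (by simpa [Formula.Realize, BoundedFormula.Realize] using hab)
      simpa [Formula.Realize, BoundedFormula.Realize] using this
    · have := H A hT h n (BoundedFormula.rel r fun i => Term.var (Sum.inl i))
        (IsPP.rel _ _) x (by simpa [Formula.Realize, BoundedFormula.Realize] using hr)
      simpa [Formula.Realize, BoundedFormula.Realize] using this
  · intro hs hdef hcore
    replace hs : IsPPSaturated L (#A) A := hs.elim id fun _ => sat_of_finite A _
    refine ⟨⟨?_⟩, ?_⟩
    · rintro σ (⟨_, h⟩ | ⟨φ, _, h, rfl⟩)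
      · exact h
      · exact (Sentence.realize_not A).2 h
    · intro B _ hB h k φ hφ a hr
      obtain ⟨e, he⟩ := exists_endo hs hB h
      let E : A →[L] A :=
        { toFun := e
          map_fun' := fun f => isEmptyElim f
          map_rel' := fun {n} r x hx => by
            have := he n (BoundedFormula.rel r fun i => Term.var (Sum.inl i)) (IsPP.rel _ _) x
              (fun _ => trivial) (h.map_rel r x hx)
            exact this }
      obtain ⟨r, hR⟩ := hdef k {x | φ.Realize x} ⟨φ, hφ, rfl⟩
      have h1 : (fun i => e (a i)) ∈ {x | φ.Realize x} := he k φ hφ a (fun _ => trivial) hr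
      rw [hR] at h1
      have h2 : a ∈ {x | φ.Realize x} := by
        rw [hR]
        exact (hcore E).2 r a h1
      exact h2

end PaperCSP
end

section
/- For a complete pp-theory T over a countable relational signature τ, the following are equivalent: (i) T has a finite or ω-categorical model; (ii) for each n, the equivalence relation ∼ₙ^T on pp-formulas in free variables x₁,…,xₙ has finite index; (iii) T has finitely many maximal pp-n-types for each n. -/
open FirstOrder FirstOrder.Language Cardinal

universe u v w

namespace PaperCSP

variable {L : FirstOrder.Language.{u, v}}

/-- A complete pp-theory: a satisfiable set of pp-sentences and negated pp-sentences
which decides every pp-sentence. -/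
def IsCompletePPTheory (T : L.Theory) : Prop :=
  (∀ σ ∈ T, IsPP σ ∨ ∃ φ : L.Sentence, IsPP φ ∧ σ = φ.not) ∧
  T.IsSatisfiable ∧
  ∀ φ : L.Sentence, IsPP φ → (φ ∈ T ∨ φ.not ∈ T)

/-- The equivalence relation `∼ₙ^T` on pp-formulas in `n` free variables. -/
def EquivPP (T : L.Theory) {n : ℕ} (φ₁ φ₂ : L.Formula (Fin n)) : Prop :=
  ∀ ψ : L.Formula (Fin n), IsPP ψ →
    (SatWith T {φ₁, ψ} ↔ SatWith T {φ₂, ψ})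

/-- `T` has a finite or `ω`-categorical model. -/
def HasFiniteOrOmegaCategoricalModel (T : L.Theory) : Prop :=
  ∃ (M : Type (max u v)) (S : L.Structure M), letI := S
    Nonempty M ∧ M ⊨ T ∧
      (Finite M ∨ (Countable M ∧
        Cardinal.Categorical (ℵ₀ : Cardinal.{max u v}) (L.completeTheory M)))

/-- `∼ₙ^T` has finite index on pp-formulas for each `n`. -/
def EquivPPFiniteIndex (T : L.Theory) : Prop :=
  ∀ n : ℕ, ∃ S : Finset (L.Formula (Fin n)), (∀ ψ ∈ S, IsPP ψ) ∧
    ∀ φ : L.Formula (Fin n), IsPP φ → ∃ ψ ∈ S, EquivPP T φ ψ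



/-! ### Closure properties of pp-formulas -/

theorem IsPP.relabelB {α β : Type} {n k : ℕ} {φ : L.BoundedFormula α k} (h : IsPP φ)
    (g : α → β ⊕ Fin n) : IsPP (φ.relabel g) := by
  induction h with
  | falsum => exact IsPP.falsum
  | equal t₁ t₂ => exact IsPP.equal _ _
  | rel R ts => exact IsPP.rel _ _
  | inf _ _ h1 h2 => exact IsPP.inf h1 h2
  | ex _ h => rw [BoundedFormula.relabel_ex]; exact IsPP.ex h

theorem IsPP.relabelF {α β : Type} {φ : L.Formula α} (h : IsPP φ)
    (g : α → β) : IsPP (φ.relabel g) := IsPP.relabelB (n := 0) h _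

theorem IsPP.exs {α : Type} : ∀ {n : ℕ} {φ : L.BoundedFormula α n}, IsPP φ → IsPP φ.exs
  | 0, _, h => h
  | _ + 1, φ, h => IsPP.exs (φ := φ.ex) (IsPP.ex h)

theorem IsPP.iExs {α β : Type} [Finite β] {φ : L.Formula (α ⊕ β)} (h : IsPP φ) :
    IsPP (φ.iExs β) := by
  unfold Formula.iExs
  exact IsPP.exs (IsPP.relabelB h _)

theorem IsPP.toFormula {α : Type} {n : ℕ} {φ : L.BoundedFormula α n} (h : IsPP φ) :
    IsPP φ.toFormula := by
  induction h with
  | falsum => exact IsPP.falsum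
  | equal t₁ t₂ => exact IsPP.equal _ _
  | rel R ts => exact IsPP.rel _ _
  | inf _ _ h1 h2 => exact IsPP.inf h1 h2
  | ex _ h => exact IsPP.ex (IsPP.relabelB h _)

/-- A pp-formula which is true in every nonempty structure. -/
def ppTrue (L : FirstOrder.Language.{u, v}) (α : Type) : L.Formula α :=
  (BoundedFormula.equal (Term.var (Sum.inr 0)) (Term.var (Sum.inr 0)) :
    L.BoundedFormula α 1).ex

theorem ppTrue_isPP {α : Type} : IsPP (ppTrue L α) := IsPP.ex (IsPP.equal _ _)

theorem ppTrue_realize {α : Type} {N : Type*} [L.Structure N] [Nonempty N] (b : α → N) :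
    (ppTrue L α).Realize b := by
  unfold ppTrue Formula.Realize
  rw [BoundedFormula.realize_ex]
  exact ⟨Classical.arbitrary N, rfl⟩

theorem exists_conj {α : Type} (s : Finset (L.Formula α)) :
    ∃ φ : L.Formula α, ((∀ ψ ∈ s, IsPP ψ) → IsPP φ) ∧
      ∀ (N : Type (max u v)) [L.Structure N] [Nonempty N] (b : α → N),
        φ.Realize b ↔ ∀ ψ ∈ s, ψ.Realize b := by
  classical
  induction s using Finset.induction_on with
  | empty => exact ⟨ppTrue L α, fun _ => ppTrue_isPP, fun N _ _ b => by simp [ppTrue_realize]⟩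
  | insert ψ s _ ih =>
    obtain ⟨φ, h1, h2⟩ := ih
    refine ⟨ψ ⊓ φ, fun h => IsPP.inf (h _ (by simp)) (h1 fun χ hχ => h _ (by simp [hχ])), ?_⟩
    intro N _ _ b
    rw [Formula.realize_inf, h2]
    simp

theorem exists_support {α : Type} (φ : L.Formula α) :
    ∃ s : Finset α, ∀ (N : Type (max u v)) [L.Structure N] (c c' : α → N),
      (∀ a ∈ s, c a = c' a) → (φ.Realize c → φ.Realize c') := by
  classical
  refine ⟨φ.freeVarFinset, ?_⟩
  intro N _ c c' h hc
  have h1 := BoundedFormula.realize_restrictFreeVar (φ := φ) (f := id)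
    (v := fun a : φ.freeVarFinset => c a) (v' := c) (xs := default) (by simp)
  have h2 := BoundedFormula.realize_restrictFreeVar (φ := φ) (f := id)
    (v := fun a : φ.freeVarFinset => c a) (v' := c') (xs := default) (by
      intro a; exact h a a.2)
  exact h2.1 (h1.2 hc)

theorem exists_proj {β : Type} {n : ℕ} (θ : L.Formula β) (i : Fin n → β) :
    ∃ θ' : L.Formula (Fin n), (IsPP θ → IsPP θ') ∧
      ∀ (N : Type (max u v)) [L.Structure N] [Nonempty N] (b : Fin n → N),
        θ'.Realize b ↔ ∃ c : β → N, c ∘ i = b ∧ θ.Realize c := by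
  classical
  obtain ⟨s, hs⟩ := exists_support θ
  let g : β → Fin n ⊕ Option s := fun m =>
    if h : ∃ j, i j = m then Sum.inl h.choose else
      if h : m ∈ s then Sum.inr (some ⟨m, h⟩) else Sum.inr none
  let E : Finset (L.Formula (Fin n)) :=
    (Finset.univ.filter fun p : Fin n × Fin n => i p.1 = i p.2).image
      fun p => (BoundedFormula.equal (Term.var (Sum.inl p.1)) (Term.var (Sum.inl p.2)) :
        L.BoundedFormula (Fin n) 0)
  obtain ⟨e, he1, he2⟩ := exists_conj E
  have hE : ∀ (N : Type (max u v)) [L.Structure N] [Nonempty N] (b : Fin n → N),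
      e.Realize b ↔ ∀ j j', i j = i j' → b j = b j' := by
    intro N _ _ b
    rw [he2]
    simp only [E, Finset.mem_image, Finset.mem_filter, Finset.mem_univ, true_and]
    constructor
    · intro h j j' hj
      exact h _ ⟨(j, j'), hj, rfl⟩
    · rintro h _ ⟨p, hp, rfl⟩
      exact h _ _ hp
  refine ⟨(θ.relabel g).iExs (Option s) ⊓ e, fun h => IsPP.inf (h.relabelF _).iExs
    (he1 ?_), ?_⟩
  · intro ψ hψ
    simp only [E, Finset.mem_image] at hψ
    obtain ⟨p, _, rfl⟩ := hψ
    exact IsPP.equal _ _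
  intro N _ _ b
  rw [Formula.realize_inf, hE, Formula.realize_iExs]
  constructor
  · rintro ⟨⟨y, hy⟩, hb⟩
    rw [Formula.realize_relabel] at hy
    refine ⟨_, ?_, hy⟩
    funext j
    have h : ∃ j', i j' = i j := ⟨j, rfl⟩
    simp only [Function.comp_apply, g, dif_pos h, Sum.elim_inl]
    exact hb _ _ h.choose_spec
  · rintro ⟨c, rfl, hc⟩
    refine ⟨⟨fun o => o.elim (Classical.arbitrary N) (fun m => c m), ?_⟩, ?_⟩
    · rw [Formula.realize_relabel]
      refine hs N _ _ ?_ hc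
      intro m hm
      by_cases h : ∃ j, i j = m
      · simp only [Function.comp_apply, g, dif_pos h, Sum.elim_inl]
        exact congrArg c h.choose_spec.symm
      · simp [g, h, hm]
    · intro j j' h
      simp [h]

theorem exists_sentence {β : Type} (θ : L.Formula β) :
    ∃ σ : L.Sentence, (IsPP θ → IsPP σ) ∧
      ∀ (N : Type (max u v)) [L.Structure N] [Nonempty N],
        N ⊨ σ ↔ ∃ c : β → N, θ.Realize c := by
  obtain ⟨θ', h1, h2⟩ := exists_proj θ (Fin.elim0 : Fin 0 → β)
  refine ⟨θ'.relabel Fin.elim0, fun h => (h1 h).relabelF _, ?_⟩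
  intro N _ _
  unfold Sentence.Realize
  rw [Formula.realize_relabel, h2]
  constructor
  · rintro ⟨c, _, hc⟩; exact ⟨c, hc⟩
  · rintro ⟨c, hc⟩; exact ⟨c, Subsingleton.elim _ _, hc⟩

/-! ### Satisfiability and compactness -/

/-- Satisfiability of a set of formulas together with `T`. -/
def Sat (T : L.Theory) {α : Type} (Φ : Set (L.Formula α)) : Prop :=
  ∃ (N : Type (max u v)) (S : L.Structure N), letI := S
    Nonempty N ∧ N ⊨ T ∧ ∃ b : α → N, ∀ φ ∈ Φ, φ.Realize b

theorem satWith_iff (T : L.Theory) {n : ℕ} (Φ : Set (L.Formula (Fin n))) :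
    SatWith T Φ ↔ Sat T Φ := Iff.rfl

theorem Sat.mono {T : L.Theory} {α : Type} {Φ Ψ : Set (L.Formula α)} (h : Sat T Ψ)
    (hs : Φ ⊆ Ψ) : Sat T Φ := by
  obtain ⟨N, S, h1, h2, b, hb⟩ := h
  exact ⟨N, S, h1, h2, b, fun φ hφ => hb φ (hs hφ)⟩

theorem sat_compact (T : L.Theory) {α : Type} (Φ : Set (L.Formula α))
    (h : ∀ s : Finset (L.Formula α), ↑s ⊆ Φ → Sat T (s : Set (L.Formula α))) : Sat T Φ := by
  classical
  let T' : L[[α]].Theory := (L.lhomWithConstants α).onTheory T ∪ Formula.equivSentence '' Φ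
  have hT' : T'.IsSatisfiable := by
    rw [Theory.isSatisfiable_iff_isFinitelySatisfiable]
    intro s hs
    obtain ⟨N, S, hN, hM, b, hb⟩ := h ((s.image Formula.equivSentence.symm).filter (· ∈ Φ))
      (by intro φ hφ; simp at hφ; exact hφ.2)
    let := S
    let : (constantsOn α).Structure N := constantsOn.structure b
    have : N ⊨ (L.lhomWithConstants α).onTheory T := (LHom.onTheory_model _ _).2 hM
    have hm : N ⊨ (s : L[[α]].Theory) := by
      rw [Theory.model_iff]
      intro σ hσ
      rcases hs hσ with h1 | ⟨φ, hφ, rfl⟩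
      · exact Theory.realize_sentence_of_mem _ h1
      · refine (Formula.realize_equivSentence _ _).2 (hb φ ?_)
        simp only [Finset.coe_filter, Finset.mem_image, Set.mem_ofPred_eq]
        exact ⟨⟨_, hσ, by simp⟩, hφ⟩
    exact Theory.Model.isSatisfiable (M := N)
  obtain ⟨M⟩ := hT'
  let S : L.Structure M := (L.lhomWithConstants α).reduct M
  have hM : (M : Type _) ⊨ T := (LHom.onTheory_model (L.lhomWithConstants α) T).1
    (M.is_model.mono Set.subset_union_left)
  refine ⟨M, S, M.nonempty', hM, fun a => (L.con a : M), fun φ hφ => ?_⟩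
  refine (Formula.realize_equivSentence _ _).1 ?_
  exact Theory.realize_sentence_of_mem T' (Or.inr ⟨φ, hφ, rfl⟩)

/-! ### Finite index and maximal types -/

theorem finiteIndex_of_finite_range (T : L.Theory) {n : ℕ} {X : Type*}
    (f : L.Formula (Fin n) → X) (hfin : (Set.range f).Finite)
    (hf : ∀ φ ψ, IsPP φ → IsPP ψ → f φ = f ψ → EquivPP T φ ψ) :
    ∃ S : Finset (L.Formula (Fin n)), (∀ ψ ∈ S, IsPP ψ) ∧
      ∀ φ : L.Formula (Fin n), IsPP φ → ∃ ψ ∈ S, EquivPP T φ ψ := by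
  obtain ⟨s', hs', hb⟩ := Set.exists_subset_bijOn {φ : L.Formula (Fin n) | IsPP φ} f
  have hfin' : s'.Finite := by
    rw [hb.finite_iff_finite]
    exact hfin.subset (Set.image_subset_range _ _)
  refine ⟨hfin'.toFinset, fun ψ hψ => hs' (by simpa using hψ), fun φ hφ => ?_⟩
  obtain ⟨ψ, hψ, he⟩ := hb.surjOn ⟨φ, hφ, rfl⟩
  exact ⟨ψ, by simpa using hψ, hf _ _ hφ (hs' hψ) he.symm⟩

theorem model_sentence_iff {T : L.Theory} (hT : IsCompletePPTheory T)
    {M N : Type (max u v)} [L.Structure M] [L.Structure N] (hM : M ⊨ T) (hN : N ⊨ T)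
    {σ : L.Sentence} (hσ : IsPP σ) (h : N ⊨ σ) : M ⊨ σ := by
  rcases hT.2.2 σ hσ with h1 | h1
  · exact Theory.realize_sentence_of_mem T h1
  · exact absurd h ((Sentence.realize_not N).1 (Theory.realize_sentence_of_mem T h1))

theorem sat_pair_iff {T : L.Theory} (hT : IsCompletePPTheory T)
    {M : Type (max u v)} [L.Structure M] [Nonempty M] (hM : M ⊨ T) {n : ℕ}
    {φ ψ : L.Formula (Fin n)} (hφ : IsPP φ) (hψ : IsPP ψ) :
    SatWith T {φ, ψ} ↔ ∃ b : Fin n → M, φ.Realize b ∧ ψ.Realize b := by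
  constructor
  · rintro ⟨N, S, hN, hNT, b, hb⟩
    let := S
    obtain ⟨σ, h1, h2⟩ := exists_sentence (φ ⊓ ψ)
    have : N ⊨ σ := (h2 N).2 ⟨b, Formula.realize_inf.2 ⟨hb _ (by simp), hb _ (by simp)⟩⟩
    obtain ⟨c, hc⟩ := (h2 M).1 (model_sentence_iff hT hM hNT (h1 (IsPP.inf hφ hψ)) this)
    exact ⟨c, Formula.realize_inf.1 hc⟩
  · rintro ⟨b, h1, h2⟩
    exact ⟨M, inferInstance, inferInstance, hM, b, by simp [h1, h2]⟩

theorem finiteIndex_of_model {T : L.Theory} (hT : IsCompletePPTheory T)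
    {M : Type (max u v)} [L.Structure M] [Nonempty M] (hM : M ⊨ T) {n : ℕ}
    (hfin : (Set.range fun φ : L.Formula (Fin n) => {b : Fin n → M | φ.Realize b}).Finite) :
    ∃ S : Finset (L.Formula (Fin n)), (∀ ψ ∈ S, IsPP ψ) ∧
      ∀ φ : L.Formula (Fin n), IsPP φ → ∃ ψ ∈ S, EquivPP T φ ψ := by
  refine finiteIndex_of_finite_range T _ hfin ?_
  intro φ ψ hφ hψ h χ hχ
  rw [sat_pair_iff hT hM hφ hχ, sat_pair_iff hT hM hψ hχ]
  have : ∀ b : Fin n → M, Formula.Realize φ b ↔ Formula.Realize ψ b := fun b => Set.ext_iff.1 h b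
  simp [this]

theorem max_mem_of_equiv {T : L.Theory} {n : ℕ} {p : Set (L.Formula (Fin n))}
    (hp : IsMaximalPPType T p) {φ ψ : L.Formula (Fin n)} (hψ : IsPP ψ)
    (hφp : φ ∈ p) (h : EquivPP T φ ψ) : ψ ∈ p := by
  classical
  by_contra hn
  refine hp.2 ψ hψ hn (sat_compact T _ ?_)
  intro s hs
  obtain ⟨χ, h1, h2⟩ := exists_conj (s.erase ψ)
  have hsp : ∀ ξ ∈ s.erase ψ, ξ ∈ p := by
    intro ξ hξ
    rw [Finset.mem_erase] at hξ
    exact (hs hξ.2).resolve_left hξ.1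
  have hχ : IsPP χ := h1 fun ξ hξ => hp.1.1 _ (hsp ξ hξ)
  have : SatWith T {φ, χ} := by
    obtain ⟨N, S, hN, hNT, b, hb⟩ := hp.1.2
    refine ⟨N, S, hN, hNT, b, ?_⟩
    rintro ξ (rfl | rfl)
    · exact hb _ hφp
    · exact (h2 N b).2 fun ξ hξ => hb _ (hsp ξ hξ)
  obtain ⟨N, S, hN, hNT, b, hb⟩ := (h χ hχ).1 this
  refine ⟨N, S, hN, hNT, b, ?_⟩
  intro ξ hξ
  by_cases he : ξ = ψ
  · subst he; exact hb _ (by simp)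
  · exact (h2 N b).1 (hb χ (by simp)) ξ (Finset.mem_erase.2 ⟨he, hξ⟩)

theorem finite_max_of_finiteIndex {T : L.Theory} (h : EquivPPFiniteIndex T) (n : ℕ) :
    {p : Set (L.Formula (Fin n)) | IsMaximalPPType T p}.Finite := by
  obtain ⟨S, hS, h2⟩ := h n
  refine Set.Finite.of_finite_image (f := fun p => p ∩ (S : Set (L.Formula (Fin n)))) ?_ ?_
  · refine (S.finite_toSet.finite_subsets).subset ?_
    rintro _ ⟨p, _, rfl⟩
    exact Set.inter_subset_right
  · intro p hp q hq he
    have key : ∀ p q : Set (L.Formula (Fin n)), IsMaximalPPType T p → IsMaximalPPType T q →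
        p ∩ (S : Set (L.Formula (Fin n))) = q ∩ (S : Set (L.Formula (Fin n))) → p ⊆ q := by
      intro p q hp hq he φ hφ
      obtain ⟨ψ, hψ, hφψ⟩ := h2 φ (hp.1.1 φ hφ)
      have h3 : ψ ∈ p := max_mem_of_equiv hp (hS ψ hψ) hφ hφψ
      have h4 : ψ ∈ q := ((Set.ext_iff.1 he ψ).1 ⟨h3, hψ⟩).1
      exact max_mem_of_equiv hq (hp.1.1 φ hφ) h4 fun χ hχ => (hφψ χ hχ).symm
    exact (key p q hp hq he).antisymm (key q p hq hp he.symm)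

theorem exists_max {T : L.Theory} {n : ℕ} {p : Set (L.Formula (Fin n))} (hp : IsPPType T p) :
    ∃ q, p ⊆ q ∧ IsMaximalPPType T q := by
  classical
  obtain ⟨q, hpq, hq⟩ := zorn_subset_nonempty {q : Set (L.Formula (Fin n)) | IsPPType T q} (by
    intro c hc hch ⟨q0, hq0⟩
    refine ⟨⋃₀ c, ⟨?_, ?_⟩, fun s hs => Set.subset_sUnion_of_mem hs⟩
    · rintro φ ⟨q, hq, hφ⟩
      exact (hc hq).1 φ hφ
    · refine sat_compact T _ fun s hs => ?_
      obtain ⟨q, hq, hsq⟩ := hch.directedOn.exists_mem_subset_of_finset_subset_biUnion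
        (f := id) ⟨q0, hq0⟩ (by simpa [Set.sUnion_eq_biUnion] using hs)
      exact Sat.mono (hc hq).2 hsq) p hp
  refine ⟨q, hpq, hq.prop, fun φ hφ hn hs => hn ?_⟩
  refine hq.le_of_ge (y := insert φ q) ⟨?_, hs⟩ (Set.subset_insert _ _) (Set.mem_insert _ _)
  rintro ψ (rfl | h)
  · exact hφ
  · exact hq.prop.1 ψ h

theorem finiteIndex_of_finite_max {T : L.Theory}
    (h : ∀ n : ℕ, {p : Set (L.Formula (Fin n)) | IsMaximalPPType T p}.Finite) :
    EquivPPFiniteIndex T := by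
  intro n
  refine finiteIndex_of_finite_range T
    (fun φ => {p : Set (L.Formula (Fin n)) | IsMaximalPPType T p ∧ φ ∈ p}) ?_ ?_
  · refine ((h n).finite_subsets).subset ?_
    rintro _ ⟨φ, rfl⟩
    exact fun p hp => hp.1
  · intro φ ψ hφ hψ he χ hχ
    have key : ∀ φ ψ : L.Formula (Fin n), IsPP φ →
        ({p : Set (L.Formula (Fin n)) | IsMaximalPPType T p ∧ φ ∈ p} =
          {p : Set (L.Formula (Fin n)) | IsMaximalPPType T p ∧ ψ ∈ p}) →
        SatWith T {φ, χ} → SatWith T {ψ, χ} := by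
      intro φ ψ hφ he hs
      obtain ⟨q, hq1, hq2⟩ := exists_max (T := T) (p := {φ, χ}) ⟨by
        rintro ξ (rfl | rfl) <;> assumption, hs⟩
      have h3 : ψ ∈ q := ((Set.ext_iff.1 he q).1 ⟨hq2, hq1 (by simp)⟩).2
      refine Sat.mono hq2.1.2 ?_
      rintro ξ (rfl | rfl)
      · exact h3
      · exact hq1 (by simp)
    exact ⟨key φ ψ hφ he, key ψ φ hψ he.symm⟩

/-! ### Generic models -/

theorem generic_nat (T : L.Theory) (F : L.Formula ℕ → Prop)
    (hinf : ∀ φ ψ, F φ → F ψ → F (φ ⊓ ψ)) (htrue : F (ppTrue L ℕ)) (hT : Sat T {ppTrue L ℕ})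
    (D : ℕ → Set (L.Formula ℕ))
    (hD : ∀ k θ, F θ → Sat T {θ} → ∃ χ ∈ D k, F χ ∧ Sat T {θ ⊓ χ}) :
    ∃ (N : Type (max u v)) (S : L.Structure N), letI := S
      Nonempty N ∧ N ⊨ T ∧ ∃ c : ℕ → N, ∀ k, ∃ χ ∈ D k, F χ ∧ χ.Realize c := by
  classical
  choose! χ hχ1 hχ2 hχ3 using hD
  let st : ℕ → {θ : L.Formula ℕ // F θ ∧ Sat T {θ}} := fun k =>
    Nat.rec ⟨ppTrue L ℕ, htrue, hT⟩
      (fun k θ => ⟨θ.1 ⊓ χ k θ.1, hinf _ _ θ.2.1 (hχ2 k _ θ.2.1 θ.2.2),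
        hχ3 k _ θ.2.1 θ.2.2⟩) k
  have hst : ∀ k, (st (k + 1)).1 = (st k).1 ⊓ χ k (st k).1 := fun k => rfl
  have hmono : ∀ (N : Type (max u v)) [L.Structure N] (c : ℕ → N) (k K : ℕ), k ≤ K →
      (st K).1.Realize c → (st k).1.Realize c := by
    intro N _ c k K hk
    induction K, hk using Nat.le_induction with
    | base => exact id
    | succ K _ ih =>
      intro h
      rw [hst, Formula.realize_inf] at h
      exact ih h.1
  have hsat : Sat T (Set.range fun k => (st k).1) := by
    refine sat_compact T _ fun s hs => ?_
    have hK : ∃ K, ∀ φ ∈ s, ∃ k ≤ K, (st k).1 = φ := by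
      induction s using Finset.induction_on with
      | empty => exact ⟨0, by simp⟩
      | insert φ s _ ih =>
        obtain ⟨K, hK⟩ := ih fun φ hφ => hs (by simp [Finset.mem_coe.1 hφ])
        obtain ⟨k, hk⟩ := hs (show φ ∈ _ by simp)
        refine ⟨max K k, fun ψ hψ => ?_⟩
        rcases Finset.mem_insert.1 hψ with rfl | hψ
        · exact ⟨k, le_max_right _ _, hk⟩
        · obtain ⟨j, hj, he⟩ := hK ψ hψ
          exact ⟨j, hj.trans (le_max_left _ _), he⟩
    obtain ⟨K, hK⟩ := hK
    obtain ⟨N, S, h1, h2, c, hc⟩ := (st K).2.2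
    refine ⟨N, S, h1, h2, c, fun φ hφ => ?_⟩
    obtain ⟨k, hk, rfl⟩ := hK φ hφ
    exact hmono N c k K hk (hc _ rfl)
  obtain ⟨N, S, h1, h2, c, hc⟩ := hsat
  refine ⟨N, S, h1, h2, c, fun k => ⟨χ k (st k).1, hχ1 k _ (st k).2.1 (st k).2.2,
    hχ2 k _ (st k).2.1 (st k).2.2, ?_⟩⟩
  have := hc _ ⟨k + 1, rfl⟩
  simp only [hst, Formula.realize_inf] at this
  exact this.2

theorem sat_true {T : L.Theory} (hT : T.IsSatisfiable) {α : Type} : Sat T {ppTrue L α} := by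
  obtain ⟨M⟩ := hT
  exact ⟨M, inferInstance, M.nonempty', M.is_model, fun _ => M.nonempty'.some, by
    rintro _ rfl; exact ppTrue_realize _⟩

theorem generic_henkin [Countable L.Symbols] (T : L.Theory)
    (F : ∀ {α : Type}, L.Formula α → Prop)
    (hinf : ∀ φ ψ : L.Formula ℕ, F φ → F ψ → F (φ ⊓ ψ)) (htrue : F (ppTrue L ℕ))
    (hrel : ∀ {α β : Type} (φ : L.Formula α) (g : α → β), F φ → F (φ.relabel g))
    (hT : T.IsSatisfiable) {ι : Type} [Countable ι]
    (D : ι → Set (L.Formula ℕ))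
    (hD : ∀ k θ, F θ → Sat T {θ} → ∃ χ ∈ D k, F χ ∧ Sat T {θ ⊓ χ}) :
    ∃ (N : Type (max u v)) (S : L.Structure N), letI := S
      Nonempty N ∧ N ⊨ T ∧ ∃ c : ℕ → N,
        (∀ ψ : L.Formula (ℕ ⊕ Unit), F ψ → ∀ y : N, ψ.Realize (Sum.elim c fun _ => y) →
          ∃ i, ψ.Realize (Sum.elim c fun _ => c i)) ∧
        (∀ φ : L.Formula ℕ, F φ → φ.Realize c ∨
          ∃ χ, F χ ∧ χ.Realize c ∧ ¬ Sat T {χ ⊓ φ}) ∧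
        ∀ k, ∃ χ ∈ D k, χ.Realize c := by
  classical
  let J := (L.Formula (ℕ ⊕ Unit)) ⊕ (L.Formula ℕ) ⊕ ι
  let E : J → Set (L.Formula ℕ) := Sum.elim
    (fun ψ => {χ | F ψ → (∃ i : ℕ, χ = ψ.relabel (Sum.elim id fun _ => i)) ∨
      ∀ (N : Type (max u v)) [L.Structure N] [Nonempty N], N ⊨ T → ∀ (c : ℕ → N) (y : N),
        χ.Realize c → ¬ ψ.Realize (Sum.elim c fun _ => y)})
    (Sum.elim (fun φ => {χ | F φ → χ = φ ∨ ¬ Sat T {χ ⊓ φ}}) D)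
  have hself : ∀ θ : L.Formula ℕ, Sat T {θ} → Sat T {θ ⊓ θ} := by
    rintro θ ⟨N, S, h1, h2, c, hc⟩
    refine ⟨N, S, h1, h2, c, ?_⟩
    rintro _ rfl
    exact Formula.realize_inf.2 ⟨hc _ rfl, hc _ rfl⟩
  have hE : ∀ k θ, F θ → Sat T {θ} → ∃ χ ∈ E k, F χ ∧ Sat T {θ ⊓ χ} := by
    rintro (ψ | φ | k) θ hθ hs
    · by_cases hFψ : F ψ
      swap
      · exact ⟨θ, fun h => absurd h hFψ, hθ, hself θ hs⟩
      by_cases hex : ∃ (N : Type (max u v)) (S : L.Structure N), letI := S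
        Nonempty N ∧ N ⊨ T ∧ ∃ (c : ℕ → N) (y : N),
          θ.Realize c ∧ ψ.Realize (Sum.elim c fun _ => y)
      · obtain ⟨N, S, h1, h2, c, y, h3, h4⟩ := hex
        obtain ⟨s1, hs1⟩ := exists_support θ
        obtain ⟨s2, hs2⟩ := exists_support ψ
        obtain ⟨i, hi⟩ := Infinite.exists_notMem_finset
          (s1 ∪ s2.biUnion fun z => Sum.elim (fun m => {m}) (fun _ => ∅) z)
        simp only [Finset.mem_union, Finset.mem_biUnion, not_or, not_exists, not_and] at hi
        refine ⟨ψ.relabel (Sum.elim id fun _ => i), fun _ => Or.inl ⟨i, rfl⟩, hrel _ _ hFψ,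
          N, S, h1, h2, Function.update c i y, ?_⟩
        rintro _ rfl
        rw [Formula.realize_inf, Formula.realize_relabel]
        constructor
        · refine hs1 N c _ (fun a ha => ?_) h3
          have : a ≠ i := by rintro rfl; exact hi.1 ha
          simp [this]
        · refine hs2 N _ _ (fun a ha => ?_) h4
          rcases a with m | m
          · have : m ≠ i := by
              rintro rfl
              exact hi.2 _ ha (by simp)
            simp [this]
          · simp
      · refine ⟨θ, fun _ => Or.inr ?_, hθ, hself θ hs⟩
        intro N S h1 h2 c y h3 h4
        exact hex ⟨N, S, h1, h2, c, y, h3, h4⟩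
    · by_cases hFφ : F φ
      swap
      · exact ⟨θ, fun h => absurd h hFφ, hθ, hself θ hs⟩
      by_cases hc : Sat T {θ ⊓ φ}
      · exact ⟨φ, fun _ => Or.inl rfl, hFφ, hc⟩
      · exact ⟨θ, fun _ => Or.inr hc, hθ, hself θ hs⟩
    · exact hD k θ hθ hs
  have : Nonempty J := ⟨Sum.inr (Sum.inl (ppTrue L ℕ))⟩
  obtain ⟨e, he⟩ := exists_surjective_nat J
  obtain ⟨N, S, h1, h2, c, hc⟩ := generic_nat T F hinf htrue (sat_true hT) (fun k => E (e k))
    (fun k => hE (e k))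
  have hc' : ∀ k, ∃ χ ∈ E k, F χ ∧ Formula.Realize χ c := by
    intro k
    obtain ⟨m, rfl⟩ := he k
    exact hc m
  refine ⟨N, S, h1, h2, c, ?_, ?_, ?_⟩
  · intro ψ hψ y hy
    obtain ⟨χ, hχ, _, hr⟩ := hc' (Sum.inl ψ)
    rcases hχ hψ with ⟨i, rfl⟩ | h
    · rw [Formula.realize_relabel] at hr
      refine ⟨i, ?_⟩
      convert hr using 1
      funext z
      rcases z with z | z <;> rfl
    · exact absurd hy (h N h2 c y hr)
  · intro φ hφ
    obtain ⟨χ, hχ, hF, hr⟩ := hc' (Sum.inr (Sum.inl φ))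
    rcases hχ hφ with rfl | h
    · exact Or.inl hr
    · exact Or.inr ⟨χ, hF, hr, h⟩
  · intro k
    obtain ⟨χ, hχ, _, hr⟩ := hc' (Sum.inr (Sum.inr k))
    exact ⟨χ, hχ, hr⟩

/-- The substructure on the range of a sequence, in a relational language. -/
def rangeSub [L.IsRelational] {N : Type w} [L.Structure N] (c : ℕ → N) : L.Substructure N where
  carrier := Set.range c
  fun_mem := fun f => isEmptyElim f

theorem henkin_bounded (F : ∀ {α : Type}, L.Formula α → Prop)
    (hrel : ∀ {α β : Type} (φ : L.Formula α) (g : α → β), F φ → F (φ.relabel g))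
    {N : Type (max u v)} [L.Structure N] {c : ℕ → N}
    (hc : ∀ ψ : L.Formula (ℕ ⊕ Unit), F ψ → ∀ y : N, ψ.Realize (Sum.elim c fun _ => y) →
          ∃ i, ψ.Realize (Sum.elim c fun _ => c i))
    {α : Type} {n : ℕ} (φ : L.BoundedFormula α (n + 1)) (hφ : F φ.toFormula)
    (v : α → ℕ) (xs : Fin n → ℕ) (y : N)
    (h : φ.Realize (c ∘ v) (Fin.snoc (c ∘ xs) y)) :
    ∃ i, φ.Realize (c ∘ v) (Fin.snoc (c ∘ xs) (c i)) := by
  let g : α ⊕ Fin (n + 1) → ℕ ⊕ Unit :=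
    Sum.elim (Sum.inl ∘ v) (Fin.snoc (α := fun _ => ℕ ⊕ Unit) (Sum.inl ∘ xs) (Sum.inr ()))
  have key : ∀ y : N, (φ.toFormula.relabel g).Realize (Sum.elim c fun _ => y) ↔
      φ.Realize (c ∘ v) (Fin.snoc (c ∘ xs) y) := by
    intro y
    rw [Formula.realize_relabel, BoundedFormula.realize_toFormula]
    have : ((Sum.elim c fun _ => y) ∘ g) ∘ Sum.inr = (Fin.snoc (c ∘ xs) y : Fin (n + 1) → N) := by
      funext j
      refine Fin.lastCases ?_ (fun j => ?_) j
      · simp [g]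
      · simp [g]
    rw [this]
    rfl
  obtain ⟨i, hi⟩ := hc _ (hrel _ g hφ) y ((key y).2 h)
  exact ⟨i, (key _).1 hi⟩

theorem pp_tarski_vaught [L.IsRelational]
    {N : Type (max u v)} [L.Structure N] {c : ℕ → N}
    (hc : ∀ ψ : L.Formula (ℕ ⊕ Unit), IsPP ψ → ∀ y : N, ψ.Realize (Sum.elim c fun _ => y) →
          ∃ i, ψ.Realize (Sum.elim c fun _ => c i))
    {α : Type} {n : ℕ} {φ : L.BoundedFormula α n} (hφ : IsPP φ)
    (v : α → rangeSub (L := L) c) (xs : Fin n → rangeSub (L := L) c) :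
    φ.Realize v xs ↔ φ.Realize (fun a => (v a : N)) (fun i => (xs i : N)) := by
  have hS : ∀ {n : ℕ} (xs : Fin n → rangeSub (L := L) c),
      Sum.elim (fun a => (v a : N)) (fun i => (xs i : N)) =
        (rangeSub (L := L) c).subtype ∘ Sum.elim v xs := by
    intro n xs
    funext z
    rcases z with z | z <;> rfl
  induction hφ with
  | falsum => exact Iff.rfl
  | equal t₁ t₂ =>
    simp only [BoundedFormula.Realize]
    rw [hS, HomClass.realize_term, HomClass.realize_term]
    exact (rangeSub (L := L) c).subtype.injective.eq_iff.symm
  | rel R ts =>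
    simp only [BoundedFormula.Realize]
    rw [hS]
    simp only [HomClass.realize_term]
    exact ((rangeSub (L := L) c).subtype.map_rel R _).symm
  | inf _ _ h1 h2 =>
    rw [BoundedFormula.realize_inf, BoundedFormula.realize_inf]
    exact and_congr (h1 _) (h2 _)
  | @ex n φ hφ h =>
    rw [BoundedFormula.realize_ex, BoundedFormula.realize_ex]
    have hsn : ∀ a : rangeSub (L := L) c,
        (fun i => ((Fin.snoc xs a : Fin (n + 1) → rangeSub (L := L) c) i : N)) =
          Fin.snoc (fun i => (xs i : N)) (a : N) := by
      intro a
      funext j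
      refine Fin.lastCases ?_ (fun j => ?_) j <;> simp
    constructor
    · rintro ⟨a, ha⟩
      refine ⟨a, ?_⟩
      have ha' := (h _).1 ha
      rw [hsn] at ha'
      exact ha'
    · rintro ⟨y, hy⟩
      choose v' hv' using fun a => (v a).2
      choose xs' hxs' using fun a => (xs a).2
      have e1 : (fun a => (v a : N)) = c ∘ v' := by funext a; exact (hv' a).symm
      have e2 : (fun a => (xs a : N)) = c ∘ xs' := by funext a; exact (hxs' a).symm
      rw [e1, e2] at hy
      obtain ⟨i, hi⟩ := henkin_bounded (fun {α} φ => IsPP φ) (fun φ g h => h.relabelF g) hc φ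
        hφ.toFormula v' xs' y hy
      refine ⟨⟨c i, i, rfl⟩, ?_⟩
      refine (h _).2 ?_
      rw [hsn, e1, e2]
      exact hi

/-! ### Good models, back and forth -/

/-- A model of `T` in which every tuple has a maximal pp-type. -/
def Good (T : L.Theory) (N : Type (max u v)) [L.Structure N] : Prop :=
  N ⊨ T ∧ ∀ (n : ℕ) (φ : L.Formula (Fin n)) (b : Fin n → N), IsPP φ →
    φ.Realize b ∨ ∃ χ : L.Formula (Fin n), IsPP χ ∧ χ.Realize b ∧ ¬ SatWith T {χ, φ}

theorem satWith_of_realize {T : L.Theory} {N : Type (max u v)} [L.Structure N] [Nonempty N]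
    (hN : N ⊨ T) {n : ℕ} {φ ψ : L.Formula (Fin n)} {b : Fin n → N} (h1 : φ.Realize b)
    (h2 : ψ.Realize b) : SatWith T {φ, ψ} :=
  ⟨N, inferInstance, inferInstance, hN, b, by simp [h1, h2]⟩

theorem Good.equiv {T : L.Theory} {N : Type (max u v)} [L.Structure N] [Nonempty N]
    (hN : Good T N) {n : ℕ} {φ ψ : L.Formula (Fin n)} (hψ : IsPP ψ)
    (h : EquivPP T φ ψ) {b : Fin n → N} (hb : φ.Realize b) : ψ.Realize b := by
  rcases hN.2 n ψ b hψ with h1 | ⟨χ, hχ, h1, h2⟩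
  · exact h1
  · exfalso
    apply h2
    rw [Set.pair_comm]
    exact (h χ hχ).1 (satWith_of_realize hN.1 hb h1)

theorem exists_good [L.IsRelational] [Countable L.Symbols] {T : L.Theory}
    (hT : IsCompletePPTheory T) :
    ∃ (N : Type (max u v)) (S : L.Structure N), letI := S
      Nonempty N ∧ Countable N ∧ Good T N := by
  obtain ⟨N, S, hN, hNT, c, hH, hC, _⟩ := generic_henkin T (fun {α} φ => IsPP φ)
    (fun φ ψ h1 h2 => IsPP.inf h1 h2) ppTrue_isPP (fun φ g h => h.relabelF g) hT.2.1
    (ι := Empty) (fun _ => ∅) (fun k => k.elim)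
  have tv : ∀ {n : ℕ} {φ : L.Formula (Fin n)} (_ : IsPP φ) (b : Fin n → rangeSub (L := L) c),
      φ.Realize b ↔ φ.Realize (fun i => (b i : N)) := by
    intro n φ hφ b
    have := pp_tarski_vaught hH hφ b default
    unfold Formula.Realize
    rw [this]
    exact iff_of_eq (congrArg _ (Subsingleton.elim _ _))
  have tvs : ∀ {σ : L.Sentence} (_ : IsPP σ), rangeSub (L := L) c ⊨ σ ↔ N ⊨ σ := by
    intro σ hσ
    have := pp_tarski_vaught hH hσ default default
    unfold Sentence.Realize Formula.Realize
    rw [this]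
    exact iff_of_eq (congrArg₂ _ (Subsingleton.elim _ _) (Subsingleton.elim _ _))
  refine ⟨rangeSub (L := L) c, inferInstance, ⟨⟨c 0, 0, rfl⟩⟩, ?_, ?_, ?_⟩
  · exact Set.countable_range c
  · rw [Theory.model_iff]
    intro σ hσ
    have h1 : N ⊨ σ := Theory.realize_sentence_of_mem T hσ
    rcases hT.1 σ hσ with h | ⟨φ, h, rfl⟩
    · exact (tvs h).2 h1
    · rw [Sentence.realize_not] at h1 ⊢
      rwa [tvs h]
  · intro n φ b hφ
    choose i hi using fun j => (b j).2
    have hi' : (fun j => (b j : N)) = c ∘ i := by funext j; exact (hi j).symm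
    rcases hC (φ.relabel i) (hφ.relabelF i) with h | ⟨χ, hχ, h1, h2⟩
    · left
      rw [Formula.realize_relabel] at h
      rw [tv hφ, hi']
      exact h
    · right
      obtain ⟨χ', h3, h4⟩ := exists_proj χ i
      refine ⟨χ', h3 hχ, ?_, ?_⟩
      · rw [tv (h3 hχ), hi', h4]
        exact ⟨c, rfl, h1⟩
      · rintro ⟨N', S', hN', hNT', b', hb'⟩
        apply h2
        obtain ⟨c', hc', hr⟩ := (h4 N' b').1 (hb' χ' (by simp))
        refine ⟨N', S', hN', hNT', c', ?_⟩
        rintro _ rfl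
        rw [Formula.realize_inf, Formula.realize_relabel, hc']
        exact ⟨hr, hb' φ (by simp)⟩

theorem Good.transfer {T : L.Theory} (hfin : EquivPPFiniteIndex T)
    {M N : Type (max u v)} [L.Structure M] [L.Structure N] [Nonempty M] [Nonempty N]
    (hM : Good T M) (hN : N ⊨ L.completeTheory M) : Good T N := by
  classical
  refine ⟨?_, ?_⟩
  · have h1 := hM.1
    exact hN.mono (Theory.completeTheory.subset (T := T) (M := M))
  intro n φ b hφ
  obtain ⟨S, hS, hS2⟩ := hfin n
  obtain ⟨θ, _, hθ⟩ := exists_conj (insert φ.not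
    ((S.filter fun ψ => ¬ SatWith T {ψ, φ}).image Formula.not))
  obtain ⟨σ, _, hσ⟩ := exists_sentence θ
  have hMσ : ¬ M ⊨ σ := by
    rw [hσ]
    rintro ⟨a, ha⟩
    rw [hθ] at ha
    have h1 : ¬ φ.Realize a := Formula.realize_not.1 (ha _ (by simp))
    rcases hM.2 n φ a hφ with h2 | ⟨χ, hχ, h2, h3⟩
    · exact h1 h2
    · obtain ⟨ψ, hψ, he⟩ := hS2 χ hχ
      have h4 : ψ.Realize a := hM.equiv (hS ψ hψ) he h2
      have h5 : ¬ SatWith T {ψ, φ} := fun h => h3 ((he φ hφ).2 h)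
      refine Formula.realize_not.1 (ha ψ.not ?_) h4
      exact Finset.mem_insert_of_mem (Finset.mem_image_of_mem _ (by simp [hψ, h5]))
  have hNσ : ¬ N ⊨ σ := by
    rw [← Sentence.realize_not] at hMσ ⊢
    exact Theory.realize_sentence_of_mem (L.completeTheory M) hMσ
  by_contra hcon
  push Not at hcon
  apply hNσ
  rw [hσ]
  refine ⟨b, ?_⟩
  rw [hθ]
  intro ξ hξ
  rcases Finset.mem_insert.1 hξ with rfl | hξ
  · exact Formula.realize_not.2 hcon.1
  · obtain ⟨ψ, hψ, rfl⟩ := Finset.mem_image.1 hξ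
    rw [Finset.mem_filter] at hψ
    exact Formula.realize_not.2 fun h => hψ.2 (hcon.2 ψ (hS ψ hψ.1) h)

theorem Good.extend {T : L.Theory} (hfin : EquivPPFiniteIndex T)
    {M N : Type (max u v)} [L.Structure M] [L.Structure N] [Nonempty M] [Nonempty N]
    (hM : Good T M) (hN : Good T N) {n : ℕ} {a : Fin n → M} {b : Fin n → N}
    (hab : ∀ φ : L.Formula (Fin n), IsPP φ → (φ.Realize a ↔ φ.Realize b)) (m : M) :
    ∃ y : N, ∀ φ : L.Formula (Fin (n + 1)), IsPP φ →
      (φ.Realize (Fin.snoc a m : Fin (n + 1) → M) ↔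
        φ.Realize (Fin.snoc b y : Fin (n + 1) → N)) := by
  classical
  obtain ⟨S, hS, hS2⟩ := hfin (n + 1)
  obtain ⟨θ, hθ1, hθ⟩ := exists_conj
    (S.filter fun ψ => ψ.Realize (Fin.snoc a m : Fin (n + 1) → M))
  have hθpp : IsPP θ := hθ1 fun ψ hψ => hS ψ (Finset.mem_filter.1 hψ).1
  obtain ⟨θ', h1, h2⟩ := exists_proj θ (Fin.castSucc : Fin n → Fin (n + 1))
  have h3 : θ'.Realize a := by
    rw [h2]
    refine ⟨Fin.snoc a m, ?_, ?_⟩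
    · funext j; simp
    · rw [hθ]
      intro ψ hψ
      exact (Finset.mem_filter.1 hψ).2
  rw [hab _ (h1 hθpp), h2] at h3
  obtain ⟨c, hc, hr⟩ := h3
  rw [hθ] at hr
  have hcs : (Fin.snoc b (c (Fin.last n)) : Fin (n + 1) → N) = c := by
    funext j
    refine Fin.lastCases ?_ (fun j => ?_) j
    · simp
    · simp [← hc]
  refine ⟨c (Fin.last n), ?_⟩
  rw [hcs]
  have key : ∀ φ : L.Formula (Fin (n + 1)), IsPP φ →
      φ.Realize (Fin.snoc a m : Fin (n + 1) → M) → φ.Realize c := by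
    intro φ hφ h
    obtain ⟨ψ, hψ, he⟩ := hS2 φ hφ
    have h4 := hM.equiv (hS ψ hψ) he h
    have h5 := hr ψ (Finset.mem_filter.2 ⟨hψ, h4⟩)
    exact hN.equiv hφ (fun χ hχ => (he χ hχ).symm) h5
  refine fun φ hφ => ⟨key φ hφ, fun h => ?_⟩
  rcases hM.2 _ φ (Fin.snoc a m) hφ with h4 | ⟨χ, hχ, h4, h5⟩
  · exact h4
  · exact absurd (satWith_of_realize hN.1 (key χ hχ h4) h) h5

theorem exists_seq {X : Type*} (P : ∀ n, (Fin n → X) → Prop) (Q : ℕ → X → Prop)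
    (h0 : ∀ v, P 0 v)
    (hs : ∀ n v, P n v → ∃ x, Q n x ∧ P (n + 1) (Fin.snoc v x)) :
    ∃ f : ℕ → X, ∀ n, P n (fun i => f i) ∧ Q n (f n) := by
  choose g hg1 hg2 using hs
  let st : ∀ n, {v : Fin n → X // P n v} := fun n =>
    Nat.rec ⟨Fin.elim0, h0 _⟩ (fun n v => ⟨Fin.snoc v.1 (g n v.1 v.2), hg2 n v.1 v.2⟩) n
  have hst : ∀ n, (st (n + 1)).1 = Fin.snoc (st n).1 (g n (st n).1 (st n).2) := fun n => rfl
  refine ⟨fun n => g n (st n).1 (st n).2, fun n => ⟨?_, hg1 _ _ _⟩⟩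
  have : (st n).1 = fun i : Fin n => g i (st i).1 (st i).2 := by
    induction n with
    | zero => exact Subsingleton.elim _ _
    | succ n ih =>
      rw [hst]
      funext j
      refine Fin.lastCases ?_ (fun j => ?_) j
      · simp
      · simp [ih]
  rw [← this]
  exact (st n).2

theorem Good.nonempty_equiv [L.IsRelational] {T : L.Theory} (hT : IsCompletePPTheory T)
    (hfin : EquivPPFiniteIndex T)
    {M N : Type (max u v)} [L.Structure M] [L.Structure N] [Nonempty M] [Nonempty N]
    [Countable M] [Countable N] (hM : Good T M) (hN : Good T N) : Nonempty (M ≃[L] N) := by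
  classical
  obtain ⟨eM, heM⟩ := exists_surjective_nat M
  obtain ⟨eN, heN⟩ := exists_surjective_nat N
  obtain ⟨f, hf⟩ := exists_seq
    (P := fun n (v : Fin n → M × N) => ∀ φ : L.Formula (Fin n), IsPP φ →
      (φ.Realize (fun i => (v i).1) ↔ φ.Realize (fun i => (v i).2)))
    (Q := fun n x => (∀ k, n = 2 * k → x.1 = eM k) ∧ (∀ k, n = 2 * k + 1 → x.2 = eN k))
    (by
      intro w φ hφ
      obtain ⟨σ, h1, h2⟩ := exists_sentence φ
      constructor
      · intro h
        obtain ⟨c, hc⟩ := (h2 N).1 (model_sentence_iff hT hN.1 hM.1 (h1 hφ) ((h2 M).2 ⟨_, h⟩))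
        convert hc
      · intro h
        obtain ⟨c, hc⟩ := (h2 M).1 (model_sentence_iff hT hM.1 hN.1 (h1 hφ) ((h2 N).2 ⟨_, h⟩))
        convert hc)
    (by
      intro n w hw
      have hsn : ∀ x : M × N,
          (fun i => ((Fin.snoc w x : Fin (n + 1) → M × N) i).1) = Fin.snoc (fun i => (w i).1) x.1 ∧
          (fun i => ((Fin.snoc w x : Fin (n + 1) → M × N) i).2) =
            Fin.snoc (fun i => (w i).2) x.2 := by
        intro x
        constructor <;> funext j <;> refine Fin.lastCases ?_ (fun j => ?_) j <;> simp
      rcases Nat.even_or_odd' n with ⟨k, hk | hk⟩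
      · obtain ⟨y, hy⟩ := Good.extend hfin hM hN hw (eM k)
        refine ⟨(eM k, y), ⟨fun k' hk' => ?_, fun k' hk' => ?_⟩, ?_⟩
        · have : k = k' := by omega
          rw [this]
        · omega
        · intro φ hφ
          rw [(hsn _).1, (hsn _).2]
          exact hy φ hφ
      · obtain ⟨y, hy⟩ := Good.extend hfin hN hM (fun φ hφ => (hw φ hφ).symm) (eN k)
        refine ⟨(y, eN k), ⟨fun k' hk' => ?_, fun k' hk' => ?_⟩, ?_⟩
        · omega
        · have : k = k' := by omega
          rw [this]
        · intro φ hφ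
          rw [(hsn _).1, (hsn _).2]
          exact (hy φ hφ).symm)
  have tr : ∀ {k : ℕ} (φ : L.Formula (Fin k)) (_ : IsPP φ) (i : Fin k → ℕ),
      φ.Realize (fun j => (f (i j)).1) ↔ φ.Realize (fun j => (f (i j)).2) := by
    intro k φ hφ i
    have hlt : ∀ j, i j < Finset.univ.sup i + 1 := fun j =>
      Nat.lt_succ_of_le (Finset.le_sup (Finset.mem_univ j))
    have := (hf (Finset.univ.sup i + 1)).1 (φ.relabel fun j => ⟨i j, hlt j⟩) (hφ.relabelF _)
    rw [Formula.realize_relabel, Formula.realize_relabel] at this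
    exact this
  have heq : ∀ i j, (f i).1 = (f j).1 ↔ (f i).2 = (f j).2 := fun i j =>
    tr (k := 2) (BoundedFormula.equal (Term.var (Sum.inl 0)) (Term.var (Sum.inl 1)))
      (IsPP.equal _ _) ![i, j]
  have hsM : ∀ m : M, ∃ k, (f k).1 = m := by
    intro m
    obtain ⟨k, rfl⟩ := heM m
    exact ⟨2 * k, (hf _).2.1 k rfl⟩
  have hsN : ∀ m : N, ∃ k, (f k).2 = m := by
    intro m
    obtain ⟨k, rfl⟩ := heN m
    exact ⟨2 * k + 1, (hf _).2.2 k rfl⟩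
  choose kM hkM using hsM
  choose kN hkN using hsN
  refine ⟨{ toFun := fun m => (f (kM m)).2, invFun := fun m => (f (kN m)).1,
            left_inv := ?_, right_inv := ?_, map_fun' := fun g => isEmptyElim g,
            map_rel' := ?_ }⟩
  · intro m
    have := (heq (kN (f (kM m)).2) (kM m)).2 (hkN _)
    exact this.trans (hkM m)
  · intro m
    have := (heq (kM (f (kN m)).1) (kN m)).1 (hkM _)
    exact this.trans (hkN m)
  · intro n R x
    have := tr (k := n) (BoundedFormula.rel R fun j => Term.var (Sum.inl j)) (IsPP.rel _ _)
      (fun j => kM (x j))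
    simp only [hkM] at this
    exact this.symm

theorem hasModel_of_finiteIndex [L.IsRelational] [Countable L.Symbols] {T : L.Theory}
    (hT : IsCompletePPTheory T) (hfin : EquivPPFiniteIndex T) :
    HasFiniteOrOmegaCategoricalModel T := by
  obtain ⟨M, S, hM, hc, hg⟩ := exists_good hT
  refine ⟨M, S, hM, hg.1, Or.inr ⟨hc, ?_⟩⟩
  intro A B hA hB
  have h1 : Countable A := Cardinal.mk_le_aleph0_iff.1 hA.le
  have h2 : Countable B := Cardinal.mk_le_aleph0_iff.1 hB.le
  exact Good.nonempty_equiv hT hfin (hg.transfer hfin A.is_model) (hg.transfer hfin B.is_model)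

/-! ### Categorical models have finitely many definable relations -/

section Categorical

variable {M : Type (max u v)} [L.Structure M] [Nonempty M]

theorem sat_complete_iff {α : Type} (θ : L.Formula α) :
    Sat (L.completeTheory M) {θ} ↔ ∃ c : α → M, θ.Realize c := by
  constructor
  · rintro ⟨N, S, hN, hNT, c, hc⟩
    let := S
    obtain ⟨σ, -, h2⟩ := exists_sentence θ
    have h3 : N ⊨ σ := (h2 N).2 ⟨c, hc _ rfl⟩
    refine (h2 M).1 ?_
    by_contra hn
    have hmem : σ.not ∈ L.completeTheory M := (Sentence.realize_not M).2 hn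
    exact (Sentence.realize_not N).1 (Theory.realize_sentence_of_mem _ hmem) h3
  · rintro ⟨c, hc⟩
    exact ⟨M, inferInstance, inferInstance, inferInstance, c, by rintro _ rfl; exact hc⟩

theorem elemEquiv_of_model {N : Type (max u v)} [L.Structure N]
    (hN : N ⊨ L.completeTheory M) : M ≅[L] N := by
  rw [elementarilyEquivalent_iff]
  intro σ
  constructor
  · intro h
    exact Theory.realize_sentence_of_mem (L.completeTheory M) h
  · intro h
    by_contra hn
    have hmem : σ.not ∈ L.completeTheory M := (Sentence.realize_not M).2 hn
    exact (Sentence.realize_not N).1 (Theory.realize_sentence_of_mem _ hmem) h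

theorem equiv_of_categorical [Infinite M] [Countable M]
    (hcat : Cardinal.Categorical (ℵ₀ : Cardinal.{max u v}) (L.completeTheory M))
    (A : Type (max u v)) [L.Structure A] [Nonempty A] [Countable A]
    (hA : A ⊨ L.completeTheory M) : Nonempty (M ≃[L] A) := by
  have : Infinite A := (elemEquiv_of_model hA).infinite
  exact hcat (Theory.ModelType.of _ M) (Theory.ModelType.of _ A)
    (Cardinal.mk_eq_aleph0 M) (Cardinal.mk_eq_aleph0 A)

/-- A formula isolating a complete type of `M`. -/
def IsAtomOf (M : Type (max u v)) [L.Structure M] {n : ℕ} (φ : L.Formula (Fin n)) : Prop :=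
  (∃ b : Fin n → M, φ.Realize b) ∧ ∀ ψ : L.Formula (Fin n),
    (∀ b : Fin n → M, φ.Realize b → ψ.Realize b) ∨
      ∀ b : Fin n → M, φ.Realize b → ¬ ψ.Realize b

theorem exists_atom [L.IsRelational] [Countable L.Symbols] [Infinite M] [Countable M]
    (hcat : Cardinal.Categorical (ℵ₀ : Cardinal.{max u v}) (L.completeTheory M))
    {n : ℕ} (b₀ : Fin n → M) : ∃ φ : L.Formula (Fin n), IsAtomOf M φ ∧ φ.Realize b₀ := by
  by_contra hno
  push Not at hno
  let D : (Fin n → ℕ) → Set (L.Formula ℕ) := fun i =>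
    {χ | ∃ φ : L.Formula (Fin n), φ.Realize b₀ ∧ χ = (φ.not).relabel i}
  obtain ⟨N, S, hN, hNT, c, hc, -, hD⟩ := generic_henkin (L.completeTheory M)
    (fun {α} _ => True) (fun _ _ _ _ => trivial) trivial (fun _ _ _ => trivial)
    ⟨Theory.ModelType.of _ M⟩ D (by
      intro i θ _ hθ
      by_contra hne
      push Not at hne
      obtain ⟨θ', -, h2⟩ := exists_proj θ i
      have himp : ∀ φ : L.Formula (Fin n), φ.Realize b₀ → ∀ b : Fin n → M,
          θ'.Realize b → φ.Realize b := by
        intro φ hφ b hb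
        by_contra hnb
        refine hne _ ⟨φ, hφ, rfl⟩ trivial ?_
        rw [sat_complete_iff]
        obtain ⟨c, rfl, hc⟩ := (h2 M b).1 hb
        refine ⟨c, Formula.realize_inf.2 ⟨hc, ?_⟩⟩
        rw [Formula.realize_relabel, Formula.realize_not]
        exact hnb
      obtain ⟨c, hc⟩ := (sat_complete_iff θ).1 hθ
      have hcθ : θ'.Realize (c ∘ i) := (h2 M _).2 ⟨c, rfl, hc⟩
      have hat : IsAtomOf M θ' := by
        refine ⟨⟨c ∘ i, hcθ⟩, fun ψ => ?_⟩
        by_cases hψ : ψ.Realize b₀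
        · exact Or.inl (himp ψ hψ)
        · refine Or.inr fun b hb => ?_
          exact Formula.realize_not.1 (himp ψ.not (Formula.realize_not.2 hψ) b hb)
      have := himp θ'.not (Formula.realize_not.2 (hno θ' hat)) _ hcθ
      exact Formula.realize_not.1 this hcθ)
  have hel : ∀ {m} (φ : L.Formula (Fin m)) (x : Fin m → rangeSub (L := L) c),
      φ.Realize ((rangeSub (L := L) c).subtype ∘ x) ↔ φ.Realize x := by
    refine Embedding.isElementary_of_exists _ ?_
    intro m φ x a h
    choose x' hx' using fun j => (x j).2
    have e : (rangeSub (L := L) c).subtype ∘ x = c ∘ x' := by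
      funext j; exact (hx' j).symm
    rw [e] at h ⊢
    have e0 : (default : Empty → N) = c ∘ Empty.elim := Subsingleton.elim _ _
    rw [e0] at h ⊢
    obtain ⟨k, hk⟩ := henkin_bounded (fun {α} _ => True) (fun _ _ _ => trivial) hc φ trivial
      Empty.elim x' a h
    exact ⟨⟨c k, k, rfl⟩, hk⟩
  let emb : rangeSub (L := L) c ↪ₑ[L] N := ⟨(rangeSub (L := L) c).subtype, fun _ => hel⟩
  have hA : rangeSub (L := L) c ⊨ L.completeTheory M := (emb.theory_model_iff _).2 hNT
  have : Nonempty (rangeSub (L := L) c) := ⟨⟨c 0, 0, rfl⟩⟩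
  have : Countable (rangeSub (L := L) c) := (Set.countable_range c).to_subtype
  obtain ⟨e⟩ := equiv_of_categorical hcat (rangeSub (L := L) c) hA
  choose i hi using fun j => (e (b₀ j)).2
  obtain ⟨χ, ⟨φ, hφ, rfl⟩, hr⟩ := hD i
  rw [Formula.realize_relabel, Formula.realize_not] at hr
  apply hr
  have h1 : φ.Realize (e ∘ b₀) := (StrongHomClass.realize_formula e φ).2 hφ
  have h2 := (hel φ (e ∘ b₀)).2 h1
  have e1 : c ∘ i = (rangeSub (L := L) c).subtype ∘ (e ∘ b₀) := by
    funext j; exact hi j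
  rw [e1]
  exact h2

theorem finite_range_of_categorical [L.IsRelational] [Countable L.Symbols] [Infinite M]
    [Countable M]
    (hcat : Cardinal.Categorical (ℵ₀ : Cardinal.{max u v}) (L.completeTheory M)) (n : ℕ) :
    (Set.range fun φ : L.Formula (Fin n) => {b : Fin n → M | φ.Realize b}).Finite := by
  classical
  have hns : ¬ Sat (L.completeTheory M)
      {χ : L.Formula (Fin n) | ∃ φ, IsAtomOf M φ ∧ χ = φ.not} := by
    rintro ⟨N, S, hN, hNT, b, hb⟩
    let := S
    have hinf : Infinite N := (elemEquiv_of_model hNT).infinite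
    obtain ⟨A, hbA, hA⟩ := exists_elementarySubstructure_card_eq L (Set.range b)
      (ℵ₀ : Cardinal.{max u v}) le_rfl
      (by simp)
      (by
        have : L.card ≤ ℵ₀ := Cardinal.mk_le_aleph0_iff.2 inferInstance
        simpa using this)
      (by simp)
    have hAc : Countable A := by
      rw [← Cardinal.mk_le_aleph0_iff]
      simpa using hA.le
    have hAne : Nonempty A := by
      rw [← Cardinal.mk_ne_zero_iff]
      intro h0
      simp [h0] at hA
      exact Cardinal.aleph0_ne_zero hA.symm
    obtain ⟨e⟩ := equiv_of_categorical hcat A ((A.theory_model_iff _).2 hNT)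
    let b' : Fin n → A := fun j => ⟨b j, hbA ⟨j, rfl⟩⟩
    obtain ⟨φ, hφ, hr⟩ := exists_atom hcat (e.symm ∘ b')
    have h1 : φ.Realize b' := (StrongHomClass.realize_formula e.symm φ).1 hr
    have h2 : φ.Realize (A.subtype ∘ b') := (A.subtype.map_formula φ b').2 h1
    exact Formula.realize_not.1 (hb _ ⟨φ, hφ, rfl⟩) h2
  have hfin : ∃ s : Finset (L.Formula (Fin n)),
      (∀ χ ∈ s, ∃ φ, IsAtomOf M φ ∧ χ = φ.not) ∧
        ∀ b : Fin n → M, ∃ χ ∈ s, ¬ χ.Realize b := by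
    by_contra hcon
    push Not at hcon
    refine hns (sat_compact _ _ fun s hs => ?_)
    obtain ⟨b, hb⟩ := hcon s hs
    exact ⟨M, inferInstance, inferInstance, inferInstance, b, hb⟩
  obtain ⟨s, hs, hcov⟩ := hfin
  let g : Finset (L.Formula (Fin n)) → Set (Fin n → M) := fun t =>
    {b | ∃ χ ∈ t, ¬ χ.Realize b}
  refine ((s.powerset.finite_toSet).image g).subset ?_
  rintro _ ⟨ψ, rfl⟩
  refine ⟨s.filter fun χ => ∀ b : Fin n → M, ¬ χ.Realize b → ψ.Realize b, ?_, ?_⟩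
  · exact Finset.mem_coe.2 (Finset.mem_powerset.2 (Finset.filter_subset _ _))
  · ext b
    simp only [g, Finset.mem_filter]
    constructor
    · rintro ⟨χ, ⟨-, h⟩, hb⟩
      exact h b hb
    · intro hb
      obtain ⟨χ, hχ, hn⟩ := hcov b
      refine ⟨χ, ⟨hχ, ?_⟩, hn⟩
      obtain ⟨φ, hφ, rfl⟩ := hs χ hχ
      simp only [Formula.realize_not, not_not] at hn ⊢
      rcases hφ.2 ψ with h | h
      · exact h
      · exact absurd hb (h b hn)

end Categorical

theorem finiteIndex_of_hasModel [L.IsRelational] [Countable L.Symbols] {T : L.Theory}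
    (hT : IsCompletePPTheory T) (h : HasFiniteOrOmegaCategoricalModel T) :
    EquivPPFiniteIndex T := by
  obtain ⟨M, S, hne, hM, h⟩ := h
  let := S
  intro n
  refine finiteIndex_of_model hT hM ?_
  rcases finite_or_infinite M with hf | hi
  · exact Set.toFinite _
  · rcases h with hf | ⟨hc, hcat⟩
    · exact absurd hf (not_finite_iff_infinite.2 hi)
    · exact finite_range_of_categorical hcat n

/-- For a complete pp-theory `T` over a countable relational signature,
the following are equivalent: (i) `T` has a finite or `ω`-categorical model; (ii) `∼ₙ^T`
has finite index for each `n`; (iii) `T` has finitely many maximal pp-`n`-types for each `n`. -/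
theorem omega_categorical_characterization {L : FirstOrder.Language.{u, v}}
    [L.IsRelational] [Countable L.Symbols]
    (T : L.Theory) (hT : IsCompletePPTheory T) :
    (HasFiniteOrOmegaCategoricalModel T ↔ EquivPPFiniteIndex T) ∧
    (EquivPPFiniteIndex T ↔
      ∀ n : ℕ, {p : Set (L.Formula (Fin n)) | IsMaximalPPType T p}.Finite) := by
  exact ⟨⟨finiteIndex_of_hasModel hT, hasModel_of_finiteIndex hT⟩,
    ⟨fun h n => finite_max_of_finiteIndex h n, finiteIndex_of_finite_max⟩⟩

end PaperCSP
end
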